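/- Let S be a numerical semigroup with multiplicity e = a_1, reduction number r, and invariant δ. Then: (1) S is M-pure if and only if δ = g(a_1); (2) S is M-pure and M-additive if and only if δ = r. -/

import Mathlib

namespace GotoNS

/-- `S` is a numerical semigroup: an additive submonoid of `ℕ` with finite
complement, different from `ℕ` itself. -/
def IsNumericalSemigroup (S : Set ℕ) : Prop :=
  (0 : ℕ) ∈ S ∧ (∀ a b, a ∈ S → b ∈ S → a + b ∈ S) ∧ Sᶜ.Finite ∧ S ≠ Set.univ

/-- The multiplicity `e` of `S`: its smallest nonzero element. -/
noncomputable def mult (S : Set ℕ) : ℕ := sInf {n | n ∈ S ∧ n ≠ 0}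

/-- The Frobenius number `f` of `S`: the largest integer not in `S`. -/
noncomputable def frob (S : Set ℕ) : ℕ := sSup {n | n ∉ S}

/-- The `k`-fold sumset `kM` of `M = S \ {0}` (with `0M = {0}`). -/
def kfold (S : Set ℕ) (k : ℕ) : Set ℕ :=
  {s | ∃ c : Fin k → ℕ, (∀ i, c i ∈ S ∧ c i ≠ 0) ∧ ∑ i, c i = s}

/-- The order of `s`: the largest `k` such that `s` is a sum of `k` nonzero
elements of `S` (`ord 0 = 0`; junk value `0` off `S`). -/
noncomputable def ordS (S : Set ℕ) (s : ℕ) : ℕ := sSup {k | s ∈ kfold S k}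

/-- The Apéry set `Ap(S; n) = {w ∈ S | w - n ∉ S}`. -/
def apery (S : Set ℕ) (n : ℕ) : Set ℕ := {w | w ∈ S ∧ ∀ s ∈ S, s + n ≠ w}

/-- `σ(α) = max {ord w | w ∈ Ap(S; α)}`. -/
noncomputable def sigmaS (S : Set ℕ) (α : ℕ) : ℕ := sSup (ordS S '' apery S α)

/-- `𝒜(u) = {α ∈ {1, …, e} | u - α ∈ S}`. -/
def Aset (S : Set ℕ) (u : ℕ) : Set ℕ :=
  {α | 1 ≤ α ∧ α ≤ mult S ∧ ∃ s ∈ S, s + α = u}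

/-- The Goto number `g(u) = min {σ(α) | α ∈ 𝒜(u)}`. -/
noncomputable def goto (S : Set ℕ) (u : ℕ) : ℕ := sInf (sigmaS S '' Aset S u)

/-- `τ`: the minimal Goto number of a nonzero element of `S`. -/
noncomputable def tau (S : Set ℕ) : ℕ := sInf (goto S '' {u | u ∈ S ∧ u ≠ 0})

/-- `ρ`: the maximal Goto number of a nonzero element of `S`. -/
noncomputable def rho (S : Set ℕ) : ℕ := sSup (goto S '' {u | u ∈ S ∧ u ≠ 0})

/-- An integer belongs to `S` (viewed inside `ℤ`). -/
def memZ (S : Set ℕ) (z : ℤ) : Prop := ∃ n : ℕ, n ∈ S ∧ (n : ℤ) = z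

/-- `T = {z ∈ ℤ \ S | z + u ∈ S for all 0 ≠ u ∈ S}`. -/
def Tset (S : Set ℕ) : Set ℤ :=
  {z | ¬ memZ S z ∧ ∀ u : ℕ, u ∈ S → u ≠ 0 → memZ S (z + (u : ℤ))}

open Classical in
/-- The order of an integer, with the convention `ord z = -1` if `z ∉ S`. -/
noncomputable def ordZ (S : Set ℕ) (z : ℤ) : ℤ :=
  if 0 ≤ z ∧ z.toNat ∈ S then (ordS S z.toNat : ℤ) else -1

/-- `S` is symmetric: for integers `x + y = f`, exactly one of `x, y` lies in `S`. -/
def IsSymmetricNS (S : Set ℕ) : Prop :=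
  ∀ x y : ℤ, x + y = (frob S : ℤ) → (memZ S x ↔ ¬ memZ S y)

/-- `u ⪯ u'` iff `u' - u ∈ S`. -/
def preceq (S : Set ℕ) (u u' : ℕ) : Prop := ∃ s ∈ S, u + s = u'

/-- `u ⪯_M u'` iff `u + s = u'` and `ord u + ord s = ord u'` for some `s ∈ S`. -/
def preceqM (S : Set ℕ) (u u' : ℕ) : Prop :=
  ∃ s ∈ S, u + s = u' ∧ ordS S u + ordS S s = ordS S u'

/-- `Ap(S) \ {0}`. -/
def apNZ (S : Set ℕ) : Set ℕ := apery S (mult S) \ {0}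

/-- Minimal elements of `Ap(S) \ {0}` with respect to `⪯`. -/
def minAp (S : Set ℕ) : Set ℕ := {w | w ∈ apNZ S ∧ ∀ w' ∈ apNZ S, preceq S w' w → w' = w}

/-- Maximal elements of `Ap(S) \ {0}` with respect to `⪯`. -/
def maxAp (S : Set ℕ) : Set ℕ := {w | w ∈ apNZ S ∧ ∀ w' ∈ apNZ S, preceq S w w' → w' = w}

/-- Minimal elements of `Ap(S) \ {0}` with respect to `⪯_M`. -/
def minApM (S : Set ℕ) : Set ℕ := {w | w ∈ apNZ S ∧ ∀ w' ∈ apNZ S, preceqM S w' w → w' = w}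

/-- Maximal elements of `Ap(S) \ {0}` with respect to `⪯_M`. -/
def maxApM (S : Set ℕ) : Set ℕ := {w | w ∈ apNZ S ∧ ∀ w' ∈ apNZ S, preceqM S w w' → w' = w}

/-- `S` is pure if all elements of `maxAp S` have the same order. -/
def IsPure (S : Set ℕ) : Prop := ∀ w ∈ maxAp S, ∀ w' ∈ maxAp S, ordS S w = ordS S w'

/-- `S` is `M`-pure if all elements of `maxApM S` have the same order. -/
def IsMPure (S : Set ℕ) : Prop := ∀ w ∈ maxApM S, ∀ w' ∈ maxApM S, ordS S w = ordS S w'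

/-- `S` is `M`-additive if `ord (u + a₁) = ord u + 1` for all `u ∈ S`. -/
def IsMAdditive (S : Set ℕ) : Prop := ∀ u ∈ S, ordS S (u + mult S) = ordS S u + 1

/-- The reduction number `r = min {k | (k+1)M = a₁ + kM}`. -/
noncomputable def redNum (S : Set ℕ) : ℕ :=
  sInf {k | kfold S (k + 1) = (fun x => mult S + x) '' kfold S k}

/-- The set of minimal generators of `S`: nonzero elements of `S` that are not
sums of two nonzero elements of `S`. -/
def minGens (S : Set ℕ) : Set ℕ :=
  {a | a ∈ S ∧ a ≠ 0 ∧ ∀ x ∈ S, ∀ y ∈ S, x ≠ 0 → y ≠ 0 → x + y ≠ a}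

/-- `δ_w = max {ord w + ord w' | w' ∈ S, w + w' ∈ Ap(S)}`. -/
noncomputable def deltaI (S : Set ℕ) (w : ℕ) : ℕ :=
  sSup ((fun w' => ordS S w + ordS S w') '' {w' | w' ∈ S ∧ w + w' ∈ apery S (mult S)})

/-- `δ = min {δ_w | w ∈ Ap(S)}`. -/
noncomputable def deltaNS (S : Set ℕ) : ℕ := sInf (deltaI S '' apery S (mult S))

/-- `γ_w = max {ord w + ⌊w'/a₁⌋ | w' ∈ S, w + w' ∈ Ap(S)}`. -/
noncomputable def gammaI (S : Set ℕ) (w : ℕ) : ℕ :=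
  sSup ((fun w' => ordS S w + w' / mult S) '' {w' | w' ∈ S ∧ w + w' ∈ apery S (mult S)})

/-- `γ = min {γ_w | w ∈ Ap(S)}`. -/
noncomputable def gammaNS (S : Set ℕ) : ℕ := sInf (gammaI S '' apery S (mult S))

/-- `ord(C) = min {ord (f+1), …, ord (f+a₁)}`. -/
noncomputable def ordC (S : Set ℕ) : ℕ :=
  sInf ((fun α => ordS S (frob S + α)) '' Set.Icc 1 (mult S))


section Order

variable {S : Set ℕ}

theorem mem_kfold_zero {s : ℕ} : s ∈ kfold S 0 ↔ s = 0 := by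
  simp [kfold, eq_comm]

theorem mem_kfold_succ {k s : ℕ} :
    s ∈ kfold S (k + 1) ↔ ∃ a ∈ S, a ≠ 0 ∧ ∃ t ∈ kfold S k, a + t = s := by
  constructor
  · rintro ⟨c, hc, rfl⟩
    exact ⟨c 0, (hc 0).1, (hc 0).2, _, ⟨fun i => c i.succ, fun i => hc i.succ, rfl⟩,
      (Fin.sum_univ_succ c).symm⟩
  · rintro ⟨a, ha, ha', t, ⟨c, hc, rfl⟩, rfl⟩
    refine ⟨Fin.cons a c, fun i => ?_, by simp [Fin.sum_univ_succ]⟩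
    cases i using Fin.cases with
    | zero => exact ⟨ha, ha'⟩
    | succ i => simpa using hc i

theorem le_of_mem_kfold {k s : ℕ} (h : s ∈ kfold S k) : k ≤ s := by
  induction k generalizing s with
  | zero => exact Nat.zero_le _
  | succ k ih =>
    obtain ⟨a, -, ha, t, ht, rfl⟩ := mem_kfold_succ.1 h
    have := ih ht
    omega

theorem add_mem_kfold {k l s t : ℕ} (hs : s ∈ kfold S k) (ht : t ∈ kfold S l) :
    s + t ∈ kfold S (k + l) := by
  induction k generalizing s with
  | zero => simpa [mem_kfold_zero.1 hs] using ht
  | succ k ih =>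
    obtain ⟨a, ha, ha', u, hu, rfl⟩ := mem_kfold_succ.1 hs
    rw [Nat.add_right_comm, add_assoc]
    exact mem_kfold_succ.2 ⟨a, ha, ha', _, ih hu, (add_assoc a u t).symm⟩

theorem mem_kfold_one {s : ℕ} (hs : s ∈ S) (h0 : s ≠ 0) : s ∈ kfold S 1 :=
  mem_kfold_succ.2 ⟨s, hs, h0, 0, mem_kfold_zero.2 rfl, rfl⟩

theorem mul_mem_kfold {a : ℕ} (ha : a ∈ S) (h0 : a ≠ 0) (m : ℕ) : m * a ∈ kfold S m := by
  induction m with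
  | zero => simp [mem_kfold_zero]
  | succ m ih => rw [Nat.succ_mul]; exact add_mem_kfold ih (mem_kfold_one ha h0)

theorem sum_mem_kfold {ι : Type*} {c : ι → ℕ} (hc : ∀ i, c i ∈ S ∧ c i ≠ 0) (t : Finset ι) :
    ∑ i ∈ t, c i ∈ kfold S t.card := by
  classical
  induction t using Finset.induction_on with
  | empty => simp [mem_kfold_zero]
  | insert i t hi ih =>
    rw [Finset.sum_insert hi, Finset.card_insert_of_notMem hi]
    exact mem_kfold_succ.2 ⟨c i, (hc i).1, (hc i).2, _, ih, rfl⟩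

theorem le_ordS {k s : ℕ} (h : s ∈ kfold S k) : k ≤ ordS S s :=
  le_csSup ⟨s, fun _ => le_of_mem_kfold⟩ h

theorem ordS_zero : ordS S 0 = 0 :=
  Nat.le_zero.1 (csSup_le' fun _ => le_of_mem_kfold)

theorem mem_kfold_of_add {k d s : ℕ} (hS : IsNumericalSemigroup S) (hk : k ≠ 0)
    (h : s ∈ kfold S (k + d)) : s ∈ kfold S k := by
  induction d with
  | zero => exact h
  | succ d ih =>
    obtain ⟨k, rfl⟩ := Nat.exists_eq_succ_of_ne_zero hk
    apply ih
    rw [show k.succ + (d + 1) = (k + d + 1) + 1 by omega] at h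
    obtain ⟨a, ha, ha', t, ht, rfl⟩ := mem_kfold_succ.1 h
    obtain ⟨b, hb, hb', u, hu, rfl⟩ := mem_kfold_succ.1 ht
    rw [show k.succ + d = k + d + 1 by omega]
    exact mem_kfold_succ.2 ⟨a + b, hS.2.1 _ _ ha hb, by omega, u, hu, by omega⟩

theorem mem_kfold_of_le {k l s : ℕ} (hS : IsNumericalSemigroup S) (hk : k ≠ 0) (hkl : k ≤ l)
    (h : s ∈ kfold S l) : s ∈ kfold S k := by
  obtain ⟨d, rfl⟩ := Nat.exists_eq_add_of_le hkl
  exact mem_kfold_of_add hS hk h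

theorem mem_of_mem_kfold {k s : ℕ} (hS : IsNumericalSemigroup S) (h : s ∈ kfold S k) : s ∈ S := by
  induction k generalizing s with
  | zero => rw [mem_kfold_zero.1 h]; exact hS.1
  | succ k ih =>
    obtain ⟨a, ha, -, t, ht, rfl⟩ := mem_kfold_succ.1 h
    exact hS.2.1 _ _ ha (ih ht)

theorem mem_kfold_ordS {s : ℕ} (hs : s ∈ S) : s ∈ kfold S (ordS S s) := by
  refine Nat.sSup_mem (s := {k | s ∈ kfold S k}) ?_ ⟨s, fun _ => le_of_mem_kfold⟩
  rcases eq_or_ne s 0 with rfl | h0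
  · exact ⟨0, mem_kfold_zero.2 rfl⟩
  · exact ⟨1, mem_kfold_one hs h0⟩

theorem ordS_add_le {s t : ℕ} (hs : s ∈ S) (ht : t ∈ S) :
    ordS S s + ordS S t ≤ ordS S (s + t) :=
  le_ordS (add_mem_kfold (mem_kfold_ordS hs) (mem_kfold_ordS ht))

theorem one_le_ordS {s : ℕ} (hs : s ∈ S) (h0 : s ≠ 0) : 1 ≤ ordS S s :=
  le_ordS (mem_kfold_one hs h0)

theorem mult_mem (hS : IsNumericalSemigroup S) : mult S ∈ S ∧ mult S ≠ 0 := by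
  obtain ⟨n, hn, h0⟩ := (Set.Finite.infinite_compl hS.2.2.1).exists_gt 0
  exact Nat.sInf_mem (s := {n | n ∈ S ∧ n ≠ 0}) ⟨n, by simpa using hn, h0.ne'⟩

theorem mult_le {s : ℕ} (hs : s ∈ S) (h0 : s ≠ 0) : mult S ≤ s :=
  Nat.sInf_le (s := {n | n ∈ S ∧ n ≠ 0}) ⟨hs, h0⟩

theorem exists_mem_apery_ne_zero (hS : IsNumericalSemigroup S) :
    ∃ w ∈ apery S (mult S), w ≠ 0 := by
  classical
  obtain ⟨n, hn⟩ := (Set.ne_univ_iff_exists_notMem S).1 hS.2.2.2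
  have he := (mult_mem hS).2
  have hex : ∃ k, n + k * mult S ∈ S := by
    by_contra! h
    exact Set.infinite_range_of_injective
      (f := fun k : ℕ => n + k * mult S) (fun a b hab => by simpa [he] using hab)
      (hS.2.2.1.subset (Set.range_subset_iff.2 h))
  have h0 : Nat.find hex ≠ 0 := fun h => hn (by simpa [h] using Nat.find_spec hex)
  obtain ⟨k, hk⟩ := Nat.exists_eq_succ_of_ne_zero h0
  have hk' := Nat.find_spec hex
  rw [hk, Nat.succ_mul] at hk'
  refine ⟨_, ⟨hk', fun s hs h => Nat.find_min hex (m := k) (by omega) ?_⟩, by omega⟩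
  rwa [show n + k * mult S = s by omega]

theorem image_subset_kfold_succ (hS : IsNumericalSemigroup S) (k : ℕ) :
    (fun x => mult S + x) '' kfold S k ⊆ kfold S (k + 1) := by
  rintro _ ⟨x, hx, rfl⟩
  exact mem_kfold_succ.2 ⟨_, (mult_mem hS).1, (mult_mem hS).2, x, hx, rfl⟩

/-- Some subsum of `2e + 1` nonzero elements of `S` is a multiple of the multiplicity `e`, and
can be traded for at least as many copies of `e`. -/
theorem exists_kfold_succ_eq_image (hS : IsNumericalSemigroup S) :
    ∃ k, kfold S (k + 1) = (fun x => mult S + x) '' kfold S k := by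
  obtain ⟨he, he0⟩ := mult_mem hS
  refine ⟨2 * mult S, Set.Subset.antisymm ?_ (image_subset_kfold_succ hS _)⟩
  rintro s ⟨c, hc, rfl⟩
  obtain ⟨t, -, htc, htd⟩ := Int.erdos_ginzburg_ziv (n := mult S) (s := Finset.univ)
    (fun i => (c i : ℤ)) (by rw [Finset.card_univ, Fintype.card_fin]; omega)
  obtain ⟨m, hm⟩ : mult S ∣ ∑ i ∈ t, c i := by exact_mod_cast htd
  have hle : mult S * mult S ≤ ∑ i ∈ t, c i := by
    have := Finset.card_nsmul_le_sum t c (mult S) fun i _ => mult_le (hc i).1 (hc i).2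
    rwa [htc, smul_eq_mul] at this
  have hem : mult S ≤ m := Nat.le_of_mul_le_mul_left (hm ▸ hle) (Nat.pos_of_ne_zero he0)
  obtain ⟨m, rfl⟩ := Nat.exists_eq_succ_of_ne_zero (by omega : m ≠ 0)
  refine ⟨m * mult S + ∑ i ∈ tᶜ, c i, ?_, ?_⟩
  · refine mem_kfold_of_le hS (by omega) ?_
      (add_mem_kfold (mul_mem_kfold he he0 m) (sum_mem_kfold hc tᶜ))
    have := Finset.card_add_card_compl t
    rw [Fintype.card_fin] at this
    omega
  · rw [← Finset.sum_add_sum_compl t c, hm, Nat.mul_succ]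
    simp only
    ring

theorem kfold_redNum (hS : IsNumericalSemigroup S) :
    kfold S (redNum S + 1) = (fun x => mult S + x) '' kfold S (redNum S) :=
  Nat.sInf_mem (s := {k | kfold S (k + 1) = (fun x => mult S + x) '' kfold S k})
    (exists_kfold_succ_eq_image hS)

theorem exists_mult_add_eq {j s : ℕ} (hS : IsNumericalSemigroup S) (hj : redNum S ≤ j)
    (hs : s ∈ kfold S (j + 1)) : ∃ t ∈ kfold S j, mult S + t = s := by
  induction j, hj using Nat.le_induction generalizing s with
  | base => rw [kfold_redNum hS] at hs; exact hs
  | succ j hj ih =>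
    obtain ⟨a, ha, ha', u, hu, rfl⟩ := mem_kfold_succ.1 hs
    obtain ⟨t, ht, rfl⟩ := ih hu
    exact ⟨a + t, mem_kfold_succ.2 ⟨a, ha, ha', t, ht, rfl⟩, by omega⟩

/-- Above the reduction number, removing `d` copies of the multiplicity lowers the order by
at most `d`. -/
theorem mem_kfold_of_add_mul_mult {n d w : ℕ} (hS : IsNumericalSemigroup S) (hn : redNum S ≤ n)
    (h : w + d * mult S ∈ kfold S (n + d)) : w ∈ kfold S n := by
  induction d with
  | zero => simpa using h
  | succ d ih =>
    obtain ⟨t, ht, hts⟩ := exists_mult_add_eq (j := n + d) hS (by omega) h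
    rw [Nat.succ_mul] at hts
    exact ih (by rwa [show w + d * mult S = t by omega])

theorem ordS_le_redNum {w : ℕ} (hS : IsNumericalSemigroup S) (hw : w ∈ apery S (mult S)) :
    ordS S w ≤ redNum S := by
  by_contra! h
  obtain ⟨t, ht, hts⟩ := exists_mult_add_eq hS le_rfl
    (mem_kfold_of_le hS (Nat.succ_ne_zero _) h (mem_kfold_ordS hw.1))
  exact hw.2 t (mem_of_mem_kfold hS ht) (by omega)

theorem zero_mem_apery (hS : IsNumericalSemigroup S) : 0 ∈ apery S (mult S) :=
  ⟨hS.1, fun s _ h => (mult_mem hS).2 (by omega)⟩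

theorem exists_apery_add_mul {u : ℕ} (hS : IsNumericalSemigroup S) (hu : u ∈ S) :
    ∃ w ∈ apery S (mult S), ∃ t, w + t * mult S = u := by
  induction u using Nat.strong_induction_on with
  | _ u ih =>
    by_cases h : ∃ s ∈ S, s + mult S = u
    · obtain ⟨s, hs, rfl⟩ := h
      obtain ⟨w, hw, t, rfl⟩ := ih s (by have := (mult_mem hS).2; omega) hs
      exact ⟨w, hw, t + 1, by ring⟩
    · exact ⟨u, ⟨hu, fun s hs h' => h ⟨s, hs, h'⟩⟩, 0, by simp⟩

theorem goto_mult (hS : IsNumericalSemigroup S) :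
    goto S (mult S) = sSup (ordS S '' apery S (mult S)) := by
  have : Aset S (mult S) = {mult S} := by
    ext α
    constructor
    · rintro ⟨h1, h2, s, hs, h⟩
      by_contra hne
      have : α ≠ mult S := hne
      have := mult_le hs (by omega)
      omega
    · rintro rfl
      exact ⟨Nat.one_le_iff_ne_zero.2 (mult_mem hS).2, le_rfl, 0, hS.1, by simp⟩
  simp [goto, this, sigmaS]

theorem ordS_le_goto {w : ℕ} (hS : IsNumericalSemigroup S) (hw : w ∈ apery S (mult S)) :
    ordS S w ≤ goto S (mult S) := by
  rw [goto_mult hS]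
  refine le_csSup ⟨redNum S, ?_⟩ ⟨w, hw, rfl⟩
  rintro _ ⟨v, hv, rfl⟩
  exact ordS_le_redNum hS hv

theorem exists_ordS_eq_goto (hS : IsNumericalSemigroup S) :
    ∃ w ∈ apery S (mult S), ordS S w = goto S (mult S) := by
  rw [goto_mult hS]
  refine Nat.sSup_mem (s := ordS S '' apery S (mult S)) ⟨_, 0, zero_mem_apery hS, rfl⟩
    ⟨redNum S, ?_⟩
  rintro _ ⟨v, hv, rfl⟩
  exact ordS_le_redNum hS hv

theorem goto_le_redNum (hS : IsNumericalSemigroup S) : goto S (mult S) ≤ redNum S := by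
  obtain ⟨w, hw, h⟩ := exists_ordS_eq_goto hS
  exact h ▸ ordS_le_redNum hS hw

theorem goto_ne_zero (hS : IsNumericalSemigroup S) : goto S (mult S) ≠ 0 := by
  obtain ⟨w, hw, h0⟩ := exists_mem_apery_ne_zero hS
  have := one_le_ordS hw.1 h0
  have := ordS_le_goto hS hw
  omega

theorem ordS_add_ordS_le_goto {w s : ℕ} (hS : IsNumericalSemigroup S) (hw : w ∈ S) (hs : s ∈ S)
    (h : w + s ∈ apery S (mult S)) : ordS S w + ordS S s ≤ goto S (mult S) :=
  (ordS_add_le hw hs).trans (ordS_le_goto hS h)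

theorem deltaI_le_goto {w : ℕ} (hS : IsNumericalSemigroup S) (hw : w ∈ S) :
    deltaI S w ≤ goto S (mult S) := by
  refine csSup_le' ?_
  rintro _ ⟨s, ⟨hs, h⟩, rfl⟩
  exact ordS_add_ordS_le_goto hS hw hs h

theorem deltaI_eq_goto_iff {w : ℕ} (hS : IsNumericalSemigroup S) (hw : w ∈ apery S (mult S)) :
    deltaI S w = goto S (mult S) ↔
      ∃ s ∈ S, w + s ∈ apery S (mult S) ∧ ordS S w + ordS S s = goto S (mult S) := by
  have hbdd : BddAbove ((fun w' => ordS S w + ordS S w') ''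
      {w' | w' ∈ S ∧ w + w' ∈ apery S (mult S)}) := by
    refine ⟨goto S (mult S), ?_⟩
    rintro _ ⟨s, ⟨hs, h⟩, rfl⟩
    exact ordS_add_ordS_le_goto hS hw.1 hs h
  constructor
  · intro h
    obtain ⟨s, ⟨hs, hws⟩, hsum⟩ := Nat.sSup_mem (Set.Nonempty.image (fun w' => ordS S w + ordS S w')
      (s := {w' | w' ∈ S ∧ w + w' ∈ apery S (mult S)}) ⟨0, hS.1, hw⟩) hbdd
    exact ⟨s, hs, hws, hsum.trans h⟩
  · rintro ⟨s, hs, hws, hsum⟩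
    exact (deltaI_le_goto hS hw.1).antisymm (hsum ▸ le_csSup hbdd ⟨s, ⟨hs, hws⟩, rfl⟩)

theorem deltaNS_le_deltaI {w : ℕ} (hw : w ∈ apery S (mult S)) : deltaNS S ≤ deltaI S w :=
  Nat.sInf_le ⟨w, hw, rfl⟩

theorem deltaNS_le_goto (hS : IsNumericalSemigroup S) : deltaNS S ≤ goto S (mult S) :=
  (deltaNS_le_deltaI (zero_mem_apery hS)).trans (deltaI_le_goto hS hS.1)

theorem deltaNS_eq_goto_iff (hS : IsNumericalSemigroup S) :
    deltaNS S = goto S (mult S) ↔ ∀ w ∈ apery S (mult S),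
      ∃ s ∈ S, w + s ∈ apery S (mult S) ∧ ordS S w + ordS S s = goto S (mult S) := by
  constructor
  · intro h w hw
    refine (deltaI_eq_goto_iff hS hw).1 ((deltaI_le_goto hS hw.1).antisymm ?_)
    exact h ▸ deltaNS_le_deltaI hw
  · intro h
    obtain ⟨w, hw, hd⟩ := Nat.sInf_mem (s := deltaI S '' apery S (mult S))
      ⟨_, 0, zero_mem_apery hS, rfl⟩
    exact hd.symm.trans ((deltaI_eq_goto_iff hS hw).2 (h w hw))

theorem eq_of_preceqM_of_ordS_eq {v w : ℕ} (h : preceqM S v w) (heq : ordS S w ≤ ordS S v) :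
    w = v := by
  obtain ⟨s, hs, rfl, hsum⟩ := h
  rcases eq_or_ne s 0 with rfl | h0
  · rfl
  · have := one_le_ordS hs h0
    omega

theorem preceqM_trans {u v w : ℕ} (hS : IsNumericalSemigroup S) (hu : u ∈ S)
    (huv : preceqM S u v) (hvw : preceqM S v w) : preceqM S u w := by
  obtain ⟨s, hs, rfl, h1⟩ := huv
  obtain ⟨t, ht, rfl, h2⟩ := hvw
  have h3 := ordS_add_le hs ht
  have h4 := ordS_add_le hu (hS.2.1 _ _ hs ht)
  rw [← add_assoc] at h4
  exact ⟨s + t, hS.2.1 _ _ hs ht, (add_assoc u s t).symm, by omega⟩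

theorem exists_maxApM {w : ℕ} (hS : IsNumericalSemigroup S) (hw : w ∈ apNZ S) :
    ∃ v ∈ maxApM S, preceqM S w v := by
  induction hn : goto S (mult S) - ordS S w using Nat.strong_induction_on generalizing w with
  | _ n ih =>
    by_cases hmax : w ∈ maxApM S
    · exact ⟨w, hmax, 0, hS.1, rfl, by rw [ordS_zero, add_zero]⟩
    · obtain ⟨v, hv, hwv, hne⟩ : ∃ v ∈ apNZ S, preceqM S w v ∧ v ≠ w := by
        by_contra! h
        exact hmax ⟨hw, h⟩
      have hlt : ordS S w < ordS S v := by
        by_contra! h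
        exact hne (eq_of_preceqM_of_ordS_eq hwv h)
      have := ordS_le_goto hS hv.1
      obtain ⟨m, hm, hvm⟩ := ih _ (by omega) hv rfl
      exact ⟨m, hm, preceqM_trans hS hw.1.1 hwv hvm⟩

theorem isMPure_iff_deltaNS_eq_goto (hS : IsNumericalSemigroup S) :
    IsMPure S ↔ deltaNS S = goto S (mult S) := by
  rw [deltaNS_eq_goto_iff hS]
  constructor
  · intro hpure w hw
    obtain ⟨m, hm, hmg⟩ := exists_ordS_eq_goto hS
    have hm0 : m ≠ 0 := by
      rintro rfl
      exact goto_ne_zero hS (hmg.symm.trans ordS_zero)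
    rcases eq_or_ne w 0 with rfl | h0
    · exact ⟨m, hm.1, by rwa [zero_add], by rw [ordS_zero, zero_add, hmg]⟩
    · have hmmax : m ∈ maxApM S := ⟨⟨hm, hm0⟩, fun v hv hmv =>
        eq_of_preceqM_of_ordS_eq hmv (hmg ▸ ordS_le_goto hS hv.1)⟩
      obtain ⟨v, hv, s, hs, rfl, hsum⟩ := exists_maxApM hS (w := w) ⟨hw, h0⟩
      exact ⟨s, hs, hv.1.1, by rw [hsum, hpure _ hv _ hmmax, hmg]⟩
  · intro h
    have key : ∀ w ∈ maxApM S, ordS S w = goto S (mult S) := by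
      intro w hw
      obtain ⟨s, hs, hws, hsum⟩ := h w hw.1.1
      have hle := ordS_add_le hw.1.1.1 hs
      have hg := ordS_le_goto hS hws
      have hw0 : w ≠ 0 := hw.1.2
      have heq := hw.2 (w + s) ⟨hws, fun h' => hw0 (by have : w + s = 0 := h'; omega)⟩
        ⟨s, hs, rfl, by omega⟩
      rw [heq] at hg hle
      omega
    intro w hw v hv
    rw [key w hw, key v hv]

theorem redNum_le_goto (hS : IsNumericalSemigroup S) (hadd : IsMAdditive S) :
    redNum S ≤ goto S (mult S) := by
  refine Nat.sInf_le (Set.Subset.antisymm (fun s hs => ?_) (image_subset_kfold_succ hS _))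
  have hord := le_ordS hs
  by_contra hne
  have hw : s ∈ apery S (mult S) := by
    refine ⟨mem_of_mem_kfold hS hs, fun t ht hts => hne ⟨t, ?_, by simp only; omega⟩⟩
    have := hadd t ht
    rw [hts] at this
    exact mem_kfold_of_le hS (goto_ne_zero hS) (by omega) (mem_kfold_ordS ht)
  have := ordS_le_goto hS hw
  omega

theorem isMAdditive_of_deltaNS_eq_redNum (hS : IsNumericalSemigroup S)
    (h : deltaNS S = redNum S) : IsMAdditive S := by
  have hgr : goto S (mult S) = redNum S :=
    (goto_le_redNum hS).antisymm (h ▸ deltaNS_le_goto hS)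
  have hδ := (deltaNS_eq_goto_iff hS).1 (h.trans hgr.symm)
  intro u hu
  obtain ⟨he, he0⟩ := mult_mem hS
  refine le_antisymm ?_ ?_
  · by_contra! hlt
    obtain ⟨w, hw, t, rfl⟩ := exists_apery_add_mul hS hu
    obtain ⟨s, hs, hws, hsum⟩ := hδ w hw
    have h1 : ordS S w + t ≤ ordS S (w + t * mult S) :=
      le_ordS (add_mem_kfold (mem_kfold_ordS hw.1) (mul_mem_kfold he he0 t))
    have hmem := add_mem_kfold (mem_kfold_ordS (hS.2.1 _ _ hu he)) (mem_kfold_ordS hs)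
    rw [show w + t * mult S + mult S + s = w + s + (t + 1) * mult S by ring] at hmem
    have h2 := mem_kfold_of_le (k := redNum S + 1 + (t + 1)) hS (by omega) (by omega) hmem
    have h3 := le_ordS (mem_kfold_of_add_mul_mult hS (Nat.le_succ _) h2)
    have h4 := ordS_le_redNum hS hws
    omega
  · exact le_ordS (add_mem_kfold (mem_kfold_ordS hu) (mem_kfold_one he he0))

end Order

/-- `M`-purity detected by `δ`. -/
theorem statement14 (S : Set ℕ) (hS : IsNumericalSemigroup S) :
    (IsMPure S ↔ deltaNS S = goto S (mult S)) ∧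
    ((IsMPure S ∧ IsMAdditive S) ↔ deltaNS S = redNum S) := by
  refine ⟨isMPure_iff_deltaNS_eq_goto hS, fun ⟨hpure, hadd⟩ => ?_, fun h => ⟨?_, ?_⟩⟩
  · rw [(isMPure_iff_deltaNS_eq_goto hS).1 hpure]
    exact (goto_le_redNum hS).antisymm (redNum_le_goto hS hadd)
  · rw [isMPure_iff_deltaNS_eq_goto hS]
    exact (deltaNS_le_goto hS).antisymm (h ▸ goto_le_redNum hS)
  · exact isMAdditive_of_deltaNS_eq_redNum hS h

end GotoNS
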